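/- arXiv:1004.4873 — 2 statements merged into one kernel-verified Lean document; each statement's English description precedes it below -/
import Mathlib

section
/- Let D ⊆ ℝⁿ be open, let b : D → ℝⁿ be C¹ with globally defined flow, let β : D → ℝ be C¹, and assume the flow ψ_β of the vector field β·b is globally defined on D × ℝ. If M is an admissible manifold of b and T ∈ ℝ, then the set M′ := {ψ_β(x,T) : x ∈ M} is also an admissible manifold of b. -/
open MeasureTheory Set Filter
open scoped RealInnerProductSpace

abbrev Euc (n : ℕ) := EuclideanSpace ℝ (Fin n)

/-- `ψ` is a globally defined flow of the vector field `b` on `D`. -/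
def GeoIsFlow {n : ℕ} (D : Set (Euc n)) (b : Euc n → Euc n)
    (ψ : Euc n → ℝ → Euc n) : Prop :=
  (∀ x ∈ D, ψ x 0 = x) ∧ (∀ x ∈ D, ∀ t : ℝ, ψ x t ∈ D) ∧
    (∀ x ∈ D, ∀ t : ℝ, HasDerivAt (ψ x) (b (ψ x t)) t)

/-- `M` is an admissible manifold of `b`. -/
def GeoIsAdmissible {n : ℕ} (D : Set (Euc n)) (b : Euc n → Euc n)
    (M : Set (Euc n)) : Prop :=
  ∃ f : Euc n → ℝ, ContinuousOn f D ∧ M = {w ∈ D | f w = 0} ∧ IsCompact M ∧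
    (∃ U : Set (Euc n), IsOpen U ∧ M ⊆ U ∧ U ⊆ D ∧ ContDiffOn ℝ 1 f U) ∧
    ∀ x ∈ M, 0 < ⟪gradient f x, b x⟫

open scoped NNReal Topology
open Metric

section General

variable {E F : Type*} [NormedAddCommGroup E] [NormedSpace ℝ E]
  [NormedAddCommGroup F] [NormedSpace ℝ F]

/-- A map which is strictly differentiable at every point of an open set is `C¹` there. -/
theorem contDiffOn_one_of_forall_hasStrictFDerivAt {f : E → F} {D : Set E} (hD : IsOpen D)
    {f' : E → E →L[ℝ] F} (hf : ∀ x ∈ D, HasStrictFDerivAt f (f' x) x) :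
    ContDiffOn ℝ 1 f D := by
  have hcont : ContinuousOn f' D := by
    intro x hx
    apply ContinuousAt.continuousWithinAt
    rw [Metric.continuousAt_iff']
    intro ε hε
    have hsub : HasStrictFDerivAt (fun y => f y - f' x y) (f' x - f' x) x :=
      (hf x hx).sub (f' x).hasStrictFDerivAt
    obtain ⟨s, hs, hLip⟩ := hsub.exists_lipschitzOnWith_of_nnnorm_lt
      ⟨ε / 2, (half_pos hε).le⟩ (by simp; exact NNReal.coe_pos.1 (half_pos hε))
    filter_upwards [eventually_mem_nhds_iff.2 hs, hD.mem_nhds hx] with y hys hyD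
    have hy : HasFDerivAt (fun z => f z - f' x z) (f' y - f' x) y :=
      (hf y hyD).hasFDerivAt.sub (f' x).hasFDerivAt
    have := hy.le_of_lip' (half_pos hε).le (by
      filter_upwards [hys] with z hz
      exact hLip.norm_sub_le hz (mem_of_mem_nhds hys))
    rw [dist_eq_norm]
    linarith
  intro x hx
  exact (contDiffAt_one_iff.2 ⟨f', D, hD.mem_nhds hx, hcont,
    fun y hy => (hf y hy).hasFDerivAt⟩).contDiffWithinAt

/-- Short-time existence of the fundamental solution of a linear ODE. -/
theorem exists_fundamental_solution [CompleteSpace E] {a : ℝ → E →L[ℝ] E} {ε : ℝ} {K : ℝ≥0}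
    (hε : 0 ≤ ε) (ha : ContinuousOn a (Icc 0 ε)) (hK : ∀ t ∈ Icc 0 ε, ‖a t‖ ≤ K)
    (hKε : 2 * K * ε ≤ 1) :
    ∃ Φ : ℝ → E →L[ℝ] E, Φ 0 = 1 ∧
      ∀ t ∈ Icc 0 ε, HasDerivWithinAt Φ (a t * Φ t) (Icc 0 ε) t := by
  have hPL : IsPicardLindelof (fun t Y => a t * Y) (⟨0, le_rfl, hε⟩ : Icc 0 ε)
      (1 : E →L[ℝ] E) 1 0 (2 * K) K := by
    refine ⟨fun t ht => ?_, fun Y _ => ha.mul continuousOn_const, fun t ht Y hY => ?_, ?_⟩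
    · refine (LipschitzWith.of_dist_le_mul fun X Y => ?_).lipschitzOnWith
      rw [dist_eq_norm, dist_eq_norm, ← mul_sub]
      exact (norm_mul_le _ _).trans (mul_le_mul_of_nonneg_right (hK t ht) (norm_nonneg _))
    · have h1 : ‖(1 : E →L[ℝ] E)‖ ≤ 1 := ContinuousLinearMap.norm_id_le
      have h2 : ‖Y - 1‖ ≤ 1 := by simpa [dist_eq_norm] using hY
      have h3 : ‖Y‖ ≤ 2 := by
        calc ‖Y‖ = ‖(Y - 1) + 1‖ := by rw [sub_add_cancel]
          _ ≤ ‖Y - 1‖ + ‖(1 : E →L[ℝ] E)‖ := norm_add_le _ _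
          _ ≤ 2 := by linarith
      calc ‖a t * Y‖ ≤ ‖a t‖ * ‖Y‖ := norm_mul_le _ _
        _ ≤ K * 2 := mul_le_mul (hK t ht) h3 (norm_nonneg _) K.2
        _ = _ := by push_cast; ring
    · simpa [hε] using hKε
  exact hPL.exists_eq_forall_mem_Icc_hasDerivWithinAt₀

theorem HasDerivWithinAt.Ici_of_Icc {f : ℝ → E} {f' : E} {a b t : ℝ}
    (h : HasDerivWithinAt f f' (Icc a b) t) (ht : t ∈ Ico a b) :
    HasDerivWithinAt f f' (Ici t) t :=
  h.mono_of_mem_nhdsWithin (mem_of_superset (Icc_mem_nhdsGE ht.2) (Icc_subset_Icc_left ht.1))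

/-- If the derivative of `g` is continuous on a closed ball, then the time-`s` map of a flow of `g`
remaining in that ball is strictly differentiable, and its derivative solves the linearised
equation. -/
theorem hasStrictFDerivAt_flow [ProperSpace E] {g : E → E} {φ : E → ℝ → E} {y z : E} {R ε : ℝ}
    {K : ℝ≥0} {V : Set E}
    (hg : ∀ x ∈ closedBall z R, DifferentiableAt ℝ g x)
    (hg' : ContinuousOn (fderiv ℝ g) (closedBall z R))
    (hK : ∀ x ∈ closedBall z R, ‖fderiv ℝ g x‖ ≤ K) (hV : V ∈ 𝓝 y)
    (hφ0 : ∀ p ∈ V, φ p 0 = p)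
    (hφR : ∀ p ∈ V, ∀ t ∈ Icc 0 ε, φ p t ∈ closedBall z R)
    (hφ : ∀ p ∈ V, ∀ t ∈ Icc 0 ε, HasDerivAt (φ p) (g (φ p t)) t)
    {Φ : ℝ → E →L[ℝ] E} (hΦ0 : Φ 0 = 1)
    (hΦ : ∀ t ∈ Icc 0 ε, HasDerivWithinAt Φ (fderiv ℝ g (φ y t) * Φ t) (Icc 0 ε) t)
    {s : ℝ} (hs : s ∈ Icc 0 ε) : HasStrictFDerivAt (fun x => φ x s) (Φ s) y := by
  have hyV : y ∈ V := mem_of_mem_nhds hV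
  have hε : 0 ≤ ε := hs.1.trans hs.2
  have hLip : LipschitzOnWith K g (closedBall z R) :=
    (convex_closedBall z R).lipschitzOnWith_of_nnnorm_fderiv_le (𝕜 := ℝ) hg
      (fun x hx => hK x hx)
  set L : ℝ := Real.exp (K * ε) with hL
  have hLpos : 0 < L := Real.exp_pos _
  have hφc : ∀ p ∈ V, ContinuousOn (φ p) (Icc 0 ε) := fun p hp t ht =>
    (hφ p hp t ht).continuousAt.continuousWithinAt
  have hφd : ∀ p ∈ V, ∀ t ∈ Ico 0 ε, HasDerivWithinAt (φ p) (g (φ p t)) (Ici t) t :=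
    fun p hp t ht => (hφ p hp t (Ico_subset_Icc_self ht)).hasDerivWithinAt
  have hdist : ∀ p ∈ V, ∀ q ∈ V, ∀ t ∈ Icc 0 ε, ‖φ p t - φ q t‖ ≤ L * ‖p - q‖ := by
    intro p hp q hq t ht
    have h := dist_le_of_trajectories_ODE_of_mem (v := fun _ => g) (s := fun _ => closedBall z R)
      (K := K) (fun _ _ => hLip) (hφc p hp) (hφd p hp)
      (fun t ht => hφR p hp t (Ico_subset_Icc_self ht)) (hφc q hq) (hφd q hq)
      (fun t ht => hφR q hq t (Ico_subset_Icc_self ht)) le_rfl t ht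
    rw [hφ0 p hp, hφ0 q hq, dist_eq_norm, dist_eq_norm, mul_comm] at h
    refine h.trans (mul_le_mul_of_nonneg_right (Real.exp_le_exp.2 ?_) (norm_nonneg _))
    exact mul_le_mul_of_nonneg_left (by linarith [ht.2]) K.2
  apply HasStrictFDerivAt.of_isLittleO
  rw [Asymptotics.isLittleO_iff]
  intro c hc
  set K' : ℝ≥0 := K + 1
  have hK'pos : (0 : ℝ) < K' := by positivity
  set C : ℝ := L / K' * Real.exp (K' * ε) with hC
  have hCpos : 0 < C := by positivity
  obtain ⟨δ, hδ, hunif⟩ := Metric.uniformContinuousOn_iff.1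
    ((isCompact_closedBall z R).uniformContinuousOn_of_continuous hg') (c / C) (by positivity)
  have hW : V ∩ ball y (δ / L) ∈ 𝓝 y := inter_mem hV (ball_mem_nhds _ (by positivity))
  filter_upwards [prod_mem_nhds hW hW] with ⟨p, q⟩ ⟨⟨hpV, hpδ⟩, ⟨hqV, hqδ⟩⟩
  have hnear : ∀ r ∈ V ∩ ball y (δ / L), ∀ t ∈ Icc 0 ε, φ r t ∈ ball (φ y t) δ := by
    intro r hr t ht
    rw [mem_ball, dist_eq_norm]
    refine (hdist r hr.1 y hyV t ht).trans_lt ?_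
    have := hr.2
    rw [mem_ball, dist_eq_norm, lt_div_iff₀ hLpos] at this
    linarith
  have hlin : ∀ t ∈ Icc 0 ε,
      ‖g (φ p t) - g (φ q t) - fderiv ℝ g (φ y t) (φ p t - φ q t)‖ ≤ c / C * (L * ‖p - q‖) := by
    intro t ht
    have h := Convex.norm_image_sub_le_of_norm_fderiv_le' (𝕜 := ℝ) (f := g) (C := c / C)
      (s := closedBall z R ∩ ball (φ y t) δ) (φ := fderiv ℝ g (φ y t))
      (fun x hx => hg x hx.1)
      (fun x hx => by
        rw [← dist_eq_norm]
        exact (hunif x hx.1 _ (hφR y hyV t ht) hx.2).le)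
      ((convex_closedBall z R).inter (convex_ball _ _))
      ⟨hφR q hqV t ht, hnear q ⟨hqV, hqδ⟩ t ht⟩ ⟨hφR p hpV t ht, hnear p ⟨hpV, hpδ⟩ t ht⟩
    exact h.trans (mul_le_mul_of_nonneg_left (hdist p hpV q hqV t ht) (by positivity))
  have hΦv : ∀ t ∈ Icc 0 ε, HasDerivWithinAt (fun t => Φ t (p - q))
      (fderiv ℝ g (φ y t) (Φ t (p - q))) (Icc 0 ε) t := fun t ht => by
    simpa using (hΦ t ht).clm_apply (hasDerivWithinAt_const t _ (p - q))
  have hgron := dist_le_of_approx_trajectories_ODE_of_mem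
    (v := fun t u => fderiv ℝ g (φ y t) u) (s := fun _ => univ) (K := K')
    (f := fun t => φ p t - φ q t) (f' := fun t => g (φ p t) - g (φ q t))
    (g := fun t => Φ t (p - q)) (g' := fun t => fderiv ℝ g (φ y t) (Φ t (p - q)))
    (a := 0) (b := ε) (εf := c / C * (L * ‖p - q‖)) (εg := 0) (δ := 0)
    (fun t ht => by
      refine (((fderiv ℝ g (φ y t)).lipschitz).weaken ?_).lipschitzOnWith
      exact (show ‖fderiv ℝ g (φ y t)‖₊ ≤ K from
        hK _ (hφR y hyV t (Ico_subset_Icc_self ht))).trans (le_add_of_nonneg_right zero_le_one))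
    ((hφc p hpV).sub (hφc q hqV))
    (fun t ht => (hφd p hpV t ht).sub (hφd q hqV t ht))
    (fun t ht => by rw [dist_eq_norm]; exact hlin t (Ico_subset_Icc_self ht))
    (fun _ _ => mem_univ _)
    (fun t ht => (hΦv t ht).continuousWithinAt)
    (fun t ht => (hΦv t (Ico_subset_Icc_self ht)).Ici_of_Icc ht)
    (fun t ht => by rw [dist_self])
    (fun _ _ => mem_univ _)
    (by simp [hφ0 p hpV, hφ0 q hqV, hΦ0]) s hs
  rw [gronwallBound_of_K_ne_0 hK'pos.ne', dist_eq_norm] at hgron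
  refine hgron.trans ?_
  have hexp : Real.exp (K' * (s - 0)) - 1 ≤ Real.exp (K' * ε) := by
    have := Real.exp_le_exp.2 (mul_le_mul_of_nonneg_left hs.2 hK'pos.le)
    rw [sub_zero]
    linarith
  calc 0 * Real.exp (K' * (s - 0)) + (c / C * (L * ‖p - q‖) + 0) / K' *
        (Real.exp (K' * (s - 0)) - 1)
      ≤ (c / C * (L * ‖p - q‖)) / K' * Real.exp (K' * ε) := by
        rw [zero_mul, zero_add, add_zero]
        exact mul_le_mul_of_nonneg_left hexp (by positivity)
    _ = c / C * C * ‖p - q‖ := by rw [hC]; ring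
    _ = c * ‖(p, q).1 - (p, q).2‖ := by rw [div_mul_cancel₀ _ hCpos.ne']

/-- Along a trajectory of `β • b`, a solution of the linearised equation which starts in the
direction of `b` remains a positive multiple of `b`. -/
theorem linearized_flow_apply_eq_smul {β : E → ℝ} {b : E → E} {γ : ℝ → E} {D : Set E}
    (hD : IsOpen D) (hb : ContDiffOn ℝ 1 b D) (hβ : ContDiffOn ℝ 1 β D)
    (hγD : ∀ t, γ t ∈ D) (hγ : ∀ t, HasDerivAt γ (β (γ t) • b (γ t)) t) {ε : ℝ} {K : ℝ≥0}
    (hK : ∀ t ∈ Icc 0 ε, ‖fderiv ℝ (fun x => β x • b x) (γ t)‖ ≤ K)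
    {Φ : ℝ → E →L[ℝ] E} (hΦ0 : Φ 0 = 1)
    (hΦ : ∀ t ∈ Icc 0 ε,
      HasDerivWithinAt Φ (fderiv ℝ (fun x => β x • b x) (γ t) * Φ t) (Icc 0 ε) t)
    {s : ℝ} (hs : s ∈ Icc 0 ε) : ∃ c : ℝ, 0 < c ∧ Φ s (b (γ 0)) = c • b (γ s) := by
  have hγc : Continuous γ := continuous_iff_continuousAt.2 fun t => (hγ t).continuousAt
  have hbd : ∀ x ∈ D, DifferentiableAt ℝ b x := fun x hx =>
    (hb.differentiableOn one_ne_zero).differentiableAt (hD.mem_nhds hx)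
  have hβd : ∀ x ∈ D, DifferentiableAt ℝ β x := fun x hx =>
    (hβ.differentiableOn one_ne_zero).differentiableAt (hD.mem_nhds hx)
  have hbγ : Continuous fun t => b (γ t) := hb.continuousOn.comp_continuous hγc hγD
  have hk : Continuous fun t => fderiv ℝ β (γ t) (b (γ t)) :=
    ((hβ.continuousOn_fderiv_of_isOpen hD le_rfl).comp_continuous hγc hγD).clm_apply hbγ
  set k : ℝ → ℝ := fun t => fderiv ℝ β (γ t) (b (γ t)) with hkdef
  set c : ℝ → ℝ := fun t => Real.exp (∫ τ in (0 : ℝ)..t, k τ) with hcdef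
  have hc : ∀ t, HasDerivAt c (c t * k t) t := fun t =>
    (hk.integral_hasStrictDerivAt 0 t).hasDerivAt.exp
  have hu : ∀ t, HasDerivAt (fun t => c t • b (γ t))
      (fderiv ℝ (fun x => β x • b x) (γ t) (c t • b (γ t))) t := by
    intro t
    have h := (hc t).smul ((hbd _ (hγD t)).hasFDerivAt.comp_hasDerivAt t (hγ t))
    refine h.congr_deriv ?_
    rw [fderiv_fun_smul (hβd _ (hγD t)) (hbd _ (hγD t))]
    simp [hkdef, smul_smul]
  refine ⟨c s, Real.exp_pos _, ?_⟩
  have hΦv : ∀ t ∈ Icc 0 ε, HasDerivWithinAt (fun t => Φ t (b (γ 0)))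
      (fderiv ℝ (fun x => β x • b x) (γ t) (Φ t (b (γ 0)))) (Icc 0 ε) t := fun t ht => by
    simpa using (hΦ t ht).clm_apply (hasDerivWithinAt_const t _ (b (γ 0)))
  exact ODE_solution_unique_of_mem_Icc_right (K := K) (s := fun _ => univ)
    (v := fun t u => fderiv ℝ (fun x => β x • b x) (γ t) u)
    (f := fun t => Φ t (b (γ 0))) (g := fun t => c t • b (γ t)) (a := 0) (b := ε)
    (fun t ht => (((fderiv ℝ (fun x => β x • b x) (γ t)).lipschitz).weaken
      (hK t (Ico_subset_Icc_self ht))).lipschitzOnWith)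
    (fun t ht => (hΦv t ht).continuousWithinAt)
    (fun t ht => (hΦv t (Ico_subset_Icc_self ht)).Ici_of_Icc ht)
    (fun _ _ => mem_univ _)
    (fun t _ => (hu t).continuousAt.continuousWithinAt)
    (fun t _ => (hu t).hasDerivWithinAt)
    (fun _ _ => mem_univ _)
    (by simp [hΦ0, hcdef]) hs

/-- A trajectory starting in a ball of half the radius stays in the ball for a short time. -/
theorem mem_closedBall_of_hasDerivAt {g : E → E} {γ : ℝ → E} {z : E} {R C ε : ℝ}
    (hC : ∀ x ∈ closedBall z R, ‖g x‖ ≤ C) (hγ0 : γ 0 ∈ closedBall z (R / 2))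
    (hC0 : 0 ≤ C) (hε : (C + 1) * ε ≤ R / 2)
    (hγ : ∀ t, HasDerivAt γ (g (γ t)) t) {t : ℝ} (ht : t ∈ Icc 0 ε) :
    γ t ∈ closedBall z R := by
  have key : ∀ t ∈ Icc 0 ε, ‖γ t - γ 0‖ ≤ (C + 1) * t → γ t ∈ closedBall z R := by
    intro t ht h
    have h1 : dist (γ t) (γ 0) ≤ R / 2 := by
      rw [dist_eq_norm]
      exact h.trans ((mul_le_mul_of_nonneg_left ht.2 (by linarith)).trans hε)
    have h2 : dist (γ 0) z ≤ R / 2 := hγ0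
    rw [mem_closedBall]
    linarith [dist_triangle (γ t) (γ 0) z]
  refine key t ht ?_
  refine image_norm_le_of_norm_deriv_right_lt_deriv_boundary
    (f := fun t => γ t - γ 0) (f' := fun t => g (γ t)) (a := 0) (b := ε)
    (B := fun t => (C + 1) * t) (B' := fun _ => C + 1)
    (fun t _ => ((hγ t).sub_const _).continuousAt.continuousWithinAt)
    (fun t _ => ((hγ t).sub_const _).hasDerivWithinAt) (by simp)
    (fun t => by simpa using (hasDerivAt_id t).const_mul (C + 1)) ?_ ht
  intro t ht h
  have := hC _ (key t (Ico_subset_Icc_self ht) h.le)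
  linarith

/-- Two global trajectories of a `C¹` vector field in an open set which agree at time `0`
coincide. -/
theorem trajectory_unique {g : E → E} {D : Set E} (hD : IsOpen D) (hg : ContDiffOn ℝ 1 g D)
    {γ η : ℝ → E} (hγD : ∀ t, γ t ∈ D)
    (hγ : ∀ t, HasDerivAt γ (g (γ t)) t) (hη : ∀ t, HasDerivAt η (g (η t)) t)
    (h0 : γ 0 = η 0) : γ = η := by
  have hγc : Continuous γ := continuous_iff_continuousAt.2 fun t => (hγ t).continuousAt
  have hηc : Continuous η := continuous_iff_continuousAt.2 fun t => (hη t).continuousAt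
  have hclopen : IsClopen {t | γ t = η t} := by
    refine ⟨isClosed_eq hγc hηc, isOpen_iff_mem_nhds.2 fun t ht => ?_⟩
    obtain ⟨K, s, hs, hLip⟩ := (hg.contDiffAt (hD.mem_nhds (hγD t))).exists_lipschitzOnWith
    refine ODE_solution_unique_of_eventually (v := fun _ => g) (s := fun _ => s) (K := K)
      (Eventually.of_forall fun _ => hLip) ?_ ?_ ht
    · filter_upwards [hγc.continuousAt hs] with τ hτ using ⟨hγ τ, hτ⟩
    · have hs' : s ∈ 𝓝 (η t) := by rwa [← show γ t = η t from ht]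
      filter_upwards [hηc.continuousAt hs'] with τ hτ using ⟨hη τ, hτ⟩
  have huniv := hclopen.eq_univ ⟨0, h0⟩
  funext t
  exact huniv.ge (mem_univ t)

end General

section Flow

variable {n : ℕ} {D : Set (Euc n)} {b : Euc n → Euc n} {β : Euc n → ℝ}
  {ψ : Euc n → ℝ → Euc n}

theorem GeoIsFlow.comp_add {g : Euc n → Euc n} (hψ : GeoIsFlow D g ψ) (hD : IsOpen D)
    (hg : ContDiffOn ℝ 1 g D) {x : Euc n} (hx : x ∈ D) (s t : ℝ) :
    ψ (ψ x s) t = ψ x (s + t) := by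
  have hs := hψ.2.1 x hx s
  refine congrFun (trajectory_unique (γ := ψ (ψ x s)) (η := fun t => ψ x (s + t)) hD hg
    (hψ.2.1 _ hs) (hψ.2.2 _ hs) (fun t => ?_) ?_) t
  · exact (hψ.2.2 x hx (s + t)).comp_const_add s t
  · simp [hψ.1 _ hs]

theorem GeoIsFlow.reverse (hψ : GeoIsFlow D (fun x => β x • b x) ψ) :
    GeoIsFlow D (fun x => -β x • b x) (fun x t => ψ x (-t)) := by
  refine ⟨fun x hx => by simpa using hψ.1 x hx, fun x hx t => hψ.2.1 x hx _, fun x hx t => ?_⟩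
  exact ((hψ.2.2 x hx (-t)).scomp t (hasDerivAt_neg t)).congr_deriv (by simp)

/-- The map `f` is strictly differentiable at `x`, with a derivative carrying `b x` to a positive
multiple of `b (f x)`. -/
def PreservesDirectionAt (b f : Euc n → Euc n) (x : Euc n) : Prop :=
  ∃ L : Euc n →L[ℝ] Euc n, HasStrictFDerivAt f L x ∧ ∃ c : ℝ, 0 < c ∧ L (b x) = c • b (f x)

theorem PreservesDirectionAt.comp {f g : Euc n → Euc n} {x : Euc n}
    (hg : PreservesDirectionAt b g (f x)) (hf : PreservesDirectionAt b f x) :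
    PreservesDirectionAt b (g ∘ f) x := by
  obtain ⟨L, hL, c, hc, hLc⟩ := hf
  obtain ⟨L', hL', c', hc', hLc'⟩ := hg
  refine ⟨L'.comp L, hL'.comp x hL, c * c', mul_pos hc hc', ?_⟩
  simp [hLc, hLc', smul_smul]

theorem GeoIsFlow.exists_nhds_preservesDirectionAt
    (hψ : GeoIsFlow D (fun x => β x • b x) ψ) (hD : IsOpen D)
    (hb : ContDiffOn ℝ 1 b D) (hβ : ContDiffOn ℝ 1 β D) {z : Euc n} (hz : z ∈ D) :
    ∃ N ∈ 𝓝 z, ∃ ε > 0, ∀ y ∈ N, ∀ s ∈ Icc 0 ε,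
      PreservesDirectionAt b (fun x => ψ x s) y := by
  set g : Euc n → Euc n := fun x => β x • b x with hgdef
  have hg : ContDiffOn ℝ 1 g D := hβ.smul hb
  obtain ⟨R, hR, hRD⟩ := Metric.nhds_basis_closedBall.mem_iff.1 (hD.mem_nhds hz)
  have hg' : ContinuousOn (fderiv ℝ g) (closedBall z R) :=
    (hg.continuousOn_fderiv_of_isOpen hD le_rfl).mono hRD
  obtain ⟨C, hC⟩ := (isCompact_closedBall z R).exists_bound_of_continuousOn
    (hg.continuousOn.mono hRD)
  obtain ⟨K₀, hK₀⟩ := (isCompact_closedBall z R).exists_bound_of_continuousOn hg'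
  have hzR : z ∈ closedBall z R := mem_closedBall_self hR.le
  have hC0 : 0 ≤ C := (norm_nonneg _).trans (hC z hzR)
  lift K₀ to ℝ≥0 using (norm_nonneg _).trans (hK₀ z hzR) with K
  set ε : ℝ := min (R / 2 / (C + 1)) (1 / (2 * K + 1)) with hεdef
  have hε : 0 < ε := by positivity
  have hεC : (C + 1) * ε ≤ R / 2 := by
    have := (le_div_iff₀ (by positivity)).1 (min_le_left (R / 2 / (C + 1)) (1 / (2 * (K : ℝ) + 1)))
    linarith
  have hεK : 2 * K * ε ≤ 1 := by
    have := (le_div_iff₀ (by positivity)).1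
      (min_le_right (R / 2 / (C + 1)) (1 / (2 * (K : ℝ) + 1)))
    rw [← hεdef] at this
    linarith
  have hsub : closedBall z (R / 2) ⊆ D :=
    (closedBall_subset_closedBall (by linarith)).trans hRD
  have hstay : ∀ p ∈ closedBall z (R / 2), ∀ t ∈ Icc 0 ε, ψ p t ∈ closedBall z R :=
    fun p hp t ht => mem_closedBall_of_hasDerivAt hC (by rwa [hψ.1 p (hsub hp)]) hC0 hεC
      (hψ.2.2 p (hsub hp)) ht
  refine ⟨ball z (R / 2), ball_mem_nhds _ (by positivity), ε, hε, fun y hy s hs => ?_⟩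
  have hyb : y ∈ closedBall z (R / 2) := ball_subset_closedBall hy
  have hyD : y ∈ D := hsub hyb
  have hyc : Continuous (ψ y) :=
    continuous_iff_continuousAt.2 fun t => (hψ.2.2 y hyD t).continuousAt
  have hbound : ∀ t ∈ Icc 0 ε, ‖fderiv ℝ g (ψ y t)‖ ≤ K := fun t ht =>
    hK₀ _ (hstay y hyb t ht)
  obtain ⟨Φ, hΦ0, hΦ⟩ := exists_fundamental_solution hε.le
    (hg'.comp hyc.continuousOn (hstay y hyb)) hbound hεK
  refine ⟨Φ s, ?_, ?_⟩
  · exact hasStrictFDerivAt_flow (V := closedBall z (R / 2))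
      (fun x hx => (hg.differentiableOn one_ne_zero).differentiableAt (hD.mem_nhds (hRD hx)))
      hg' hK₀ (mem_of_superset (isOpen_ball.mem_nhds hy) ball_subset_closedBall)
      (fun p hp => hψ.1 p (hsub hp)) hstay (fun p hp t _ => hψ.2.2 p (hsub hp) t) hΦ0 hΦ hs
  · have := linearized_flow_apply_eq_smul hD hb hβ (hψ.2.1 y hyD) (hψ.2.2 y hyD) hbound hΦ0 hΦ hs
    rwa [hψ.1 y hyD] at this

theorem GeoIsFlow.preservesDirectionAt_of_nonneg
    (hψ : GeoIsFlow D (fun x => β x • b x) ψ) (hD : IsOpen D)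
    (hb : ContDiffOn ℝ 1 b D) (hβ : ContDiffOn ℝ 1 β D) {x : Euc n} (hx : x ∈ D) {t : ℝ}
    (ht : 0 ≤ t) : PreservesDirectionAt b (fun y => ψ y t) x := by
  have hxc : Continuous (ψ x) :=
    continuous_iff_continuousAt.2 fun t => (hψ.2.2 x hx t).continuousAt
  obtain ⟨ε, hε, hunif⟩ : ∃ ε > 0, ∀ y ∈ ψ x '' Icc 0 t, ∀ s ∈ Icc 0 ε,
      PreservesDirectionAt b (fun x => ψ x s) y := by
    refine (isCompact_Icc.image hxc).induction_on
      (p := fun S => ∃ ε > 0, ∀ y ∈ S, ∀ s ∈ Icc 0 ε, PreservesDirectionAt b (fun x => ψ x s) y)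
      ⟨1, one_pos, by simp⟩ ?_ ?_ ?_
    · rintro S S' hSS' ⟨ε, hε, h⟩
      exact ⟨ε, hε, fun y hy => h y (hSS' hy)⟩
    · rintro S S' ⟨ε, hε, h⟩ ⟨ε', hε', h'⟩
      refine ⟨min ε ε', lt_min hε hε', ?_⟩
      rintro y (hy | hy) s hs
      · exact h y hy s ⟨hs.1, hs.2.trans (min_le_left _ _)⟩
      · exact h' y hy s ⟨hs.1, hs.2.trans (min_le_right _ _)⟩
    · rintro _ ⟨τ, -, rfl⟩
      obtain ⟨N, hN, ε, hε, h⟩ := hψ.exists_nhds_preservesDirectionAt hD hb hβ (hψ.2.1 x hx τ)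
      exact ⟨N, mem_nhdsWithin_of_mem_nhds hN, ε, hε, h⟩
  obtain ⟨N, hN⟩ := exists_nat_ge (t / ε)
  have hN1 : (0 : ℝ) < N + 1 := by positivity
  set δ : ℝ := t / (N + 1) with hδ
  have hδ0 : 0 ≤ δ := by positivity
  have hδε : δ ≤ ε := by
    rw [hδ, div_le_iff₀ hN1]
    have := (div_le_iff₀ hε).1 hN
    linarith
  have hNδ : ((N + 1 : ℕ) : ℝ) * δ = t := by
    rw [hδ]
    push_cast
    field_simp
  have hind : ∀ k : ℕ, k ≤ N + 1 → PreservesDirectionAt b (fun y => ψ y (k * δ)) x := by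
    intro k
    induction k with
    | zero =>
      intro _
      have h := hunif x ⟨0, ⟨le_rfl, ht⟩, hψ.1 x hx⟩ 0 ⟨le_rfl, hε.le⟩
      simpa using h
    | succ k ih =>
      intro hk
      have hkt : (k : ℝ) * δ ∈ Icc 0 t := by
        refine ⟨by positivity, ?_⟩
        rw [← hNδ]
        exact mul_le_mul_of_nonneg_right (by exact_mod_cast (Nat.le_succ k).trans hk) hδ0
      have hcomp := (hunif _ ⟨_, hkt, rfl⟩ δ ⟨hδ0, hδε⟩).comp
        (f := fun y => ψ y (k * δ)) (ih ((Nat.le_succ k).trans hk))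
      obtain ⟨L, hL, c, hc, hLc⟩ := hcomp
      have heq : ∀ y ∈ D, ψ (ψ y (k * δ)) δ = ψ y ((k + 1 : ℕ) * δ) := fun y hy => by
        rw [hψ.comp_add hD (hβ.smul hb) hy]
        push_cast
        ring_nf
      refine ⟨L, hL.congr_of_eventuallyEq ?_, c, hc, ?_⟩
      · filter_upwards [hD.mem_nhds hx] with y hy using heq y hy
      · rw [hLc, Function.comp_apply, heq x hx]
  simpa only [hNδ] using hind (N + 1) le_rfl

theorem GeoIsFlow.preservesDirectionAt
    (hψ : GeoIsFlow D (fun x => β x • b x) ψ) (hD : IsOpen D)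
    (hb : ContDiffOn ℝ 1 b D) (hβ : ContDiffOn ℝ 1 β D) {x : Euc n} (hx : x ∈ D) (t : ℝ) :
    PreservesDirectionAt b (fun y => ψ y t) x := by
  rcases le_total 0 t with ht | ht
  · exact hψ.preservesDirectionAt_of_nonneg hD hb hβ hx ht
  · simpa using hψ.reverse.preservesDirectionAt_of_nonneg hD hb hβ.neg hx (neg_nonneg.2 ht)

end Flow

/-- moving an admissible manifold of `b` with the flow of `β·b`
for a fixed time yields another admissible manifold of `b`. -/
theorem statement11 {n : ℕ} (D : Set (Euc n)) (hD : IsOpen D) (hDne : D.Nonempty)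
    (b : Euc n → Euc n) (hb : ContDiffOn ℝ 1 b D)
    (ψ : Euc n → ℝ → Euc n) (hψ : GeoIsFlow D b ψ)
    (β : Euc n → ℝ) (hβ : ContDiffOn ℝ 1 β D)
    (ψβ : Euc n → ℝ → Euc n)
    (hψβ0 : ∀ x ∈ D, ψβ x 0 = x)
    (hψβD : ∀ x ∈ D, ∀ t : ℝ, ψβ x t ∈ D)
    (hψβderiv : ∀ x ∈ D, ∀ t : ℝ, HasDerivAt (ψβ x) (β (ψβ x t) • b (ψβ x t)) t)
    (M : Set (Euc n)) (hM : GeoIsAdmissible D b M) (T : ℝ) :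
    GeoIsAdmissible D b ((fun x => ψβ x T) '' M) := by
  have hflow : GeoIsFlow D (fun x => β x • b x) ψβ := ⟨hψβ0, hψβD, hψβderiv⟩
  have hinv : ∀ x ∈ D, ∀ t : ℝ, ψβ (ψβ x t) (-t) = x := fun x hx t => by
    rw [hflow.comp_add hD (hβ.smul hb) hx, add_neg_cancel, hψβ0 x hx]
  have hsmooth : ∀ t : ℝ, ContDiffOn ℝ 1 (fun x => ψβ x t) D := fun t => by
    choose! L hL using fun x (hx : x ∈ D) => hflow.preservesDirectionAt hD hb hβ hx t
    exact contDiffOn_one_of_forall_hasStrictFDerivAt hD fun x hx => (hL x hx).1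
  obtain ⟨f, hf, hMf, hMc, ⟨U, hU, hMU, hUD, hfU⟩, hpos⟩ := hM
  have hMD : M ⊆ D := hMU.trans hUD
  refine ⟨fun x => f (ψβ x (-T)), hf.comp (hsmooth (-T)).continuousOn fun x hx => hψβD x hx _,
    ?_, hMc.image_of_continuousOn ((hsmooth T).continuousOn.mono hMD),
    ⟨D ∩ (fun x => ψβ x (-T)) ⁻¹' U,
      (hsmooth (-T)).continuousOn.isOpen_inter_preimage hD hU, ?_, inter_subset_left, ?_⟩, ?_⟩
  · ext y
    constructor
    · rintro ⟨x, hx, rfl⟩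
      refine ⟨hψβD x (hMD hx) T, ?_⟩
      have hfx : x ∈ {w ∈ D | f w = 0} := hMf ▸ hx
      simpa only [hinv x (hMD hx)] using hfx.2
    · rintro ⟨hyD, hy⟩
      refine ⟨ψβ y (-T), ?_, by simpa using hinv y hyD (-T)⟩
      rw [hMf]
      exact ⟨hψβD y hyD _, hy⟩
  · rintro _ ⟨x, hx, rfl⟩
    refine ⟨hψβD x (hMD hx) T, ?_⟩
    simpa only [mem_preimage, hinv x (hMD hx)] using hMU hx
  · exact hfU.comp ((hsmooth (-T)).mono inter_subset_left) fun x hx => hx.2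
  · rintro _ ⟨x, hx, rfl⟩
    have hyD := hψβD x (hMD hx) T
    obtain ⟨L, hL, c, hc, hLc⟩ := hflow.preservesDirectionAt hD hb hβ hyD (-T)
    have hxeq := hinv x (hMD hx) T
    have hfx : HasFDerivAt f (fderiv ℝ f x) (ψβ (ψβ x T) (-T)) := by
      rw [hxeq]
      exact ((hfU.differentiableOn one_ne_zero).differentiableAt
        (hU.mem_nhds (hMU hx))).hasFDerivAt
    have hcomp : HasFDerivAt (fun y => f (ψβ y (-T))) ((fderiv ℝ f x).comp L) (ψβ x T) :=
      hfx.comp (ψβ x T) hL.hasFDerivAt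
    have hposx := hpos x hx
    rw [inner_gradient_left] at hposx ⊢
    simp only [hxeq] at hLc
    rw [hcomp.fderiv, ContinuousLinearMap.comp_apply, hLc, map_smul]
    exact mul_pos hc hposx
end

section
/- Let D ⊆ ℝⁿ be open, let b : D → ℝⁿ be C¹ with globally defined flow ψ, and let M ⊆ D be an admissible manifold of b. Then there exist ε > 0 and a continuous function f : D → ℝ such that: (i) f⁻¹({0}) = M; (ii) f traces the flowlines of b between the values −ε and ε, and on E := f⁻¹((−ε,ε)) one has ⟨∇f(x), b(x)⟩ = |b(x)|; (iii) the closure of E is a compact subset of D; (iv) b(x) ≠ 0 for every x in the closure of E; (v) sup_{x ∈ E} |∇f(x)| < ∞. -/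
open MeasureTheory Set Filter
open scoped RealInnerProductSpace

section Nemytskii

variable {K F G : Type*} [TopologicalSpace K] [CompactSpace K]
  [NormedAddCommGroup F] [NormedSpace ℝ F] [NormedAddCommGroup G] [NormedSpace ℝ G]

/-- Pointwise application of a continuous family of operators, as a bounded bilinear map. -/
noncomputable def pointwiseApplyL : C(K, F →L[ℝ] G) →L[ℝ] C(K, F) →L[ℝ] C(K, G) :=
  LinearMap.mkContinuous₂
    (LinearMap.mk₂ ℝ
      (fun (A : C(K, F →L[ℝ] G)) (h : C(K, F)) =>
        (⟨fun s => A s (h s), by fun_prop⟩ : C(K, G)))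
      (by intros; ext; simp) (by intros; ext; simp) (by intros; ext; simp)
      (by intros; ext; simp)) 1 (by
    intro A h
    rw [ContinuousMap.norm_le _ (by positivity)]
    intro s
    have := (A s).le_of_opNorm_le_of_le (A.norm_coe_le_norm s) (h.norm_coe_le_norm s)
    simpa using this)

@[simp]
lemma pointwiseApplyL_apply (A : C(K, F →L[ℝ] G)) (h : C(K, F)) (s : K) :
    pointwiseApplyL A h s = A s (h s) := rfl

lemma hasFDerivAt_continuousMap_comp {w : F → G} {w' : F → F →L[ℝ] G}
    (hw : ∀ x, HasFDerivAt w (w' x) x) (hwc : Continuous w) (hw' : Continuous w') (γ : C(K, F)) :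
    HasFDerivAt (fun γ : C(K, F) => (⟨w, hwc⟩ : C(F, G)).comp γ)
      (pointwiseApplyL ((⟨w', hw'⟩ : C(F, F →L[ℝ] G)).comp γ)) γ := by
  rw [hasFDerivAt_iff_isLittleO, Asymptotics.isLittleO_iff]
  intro c hc
  have hcont : ContinuousAt
      (fun γ : C(K, F) => (⟨w', hw'⟩ : C(F, F →L[ℝ] G)).comp γ) γ :=
    (ContinuousMap.continuous_postcomp _).continuousAt
  obtain ⟨δ, hδ, hclose⟩ := (Metric.continuousAt_iff (α := C(K, F)) (β := C(K, F →L[ℝ] G))).1 hcont c hc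
  have key : ∀ s : K, ∀ ξ ∈ Metric.ball (γ s) δ, ‖w' ξ - w' (γ s)‖ ≤ c := by
    intro s ξ hξ
    have h1 : dist (γ + ContinuousMap.const K (ξ - γ s)) γ < δ := by
      rw [dist_eq_norm, add_sub_cancel_left]
      refine lt_of_le_of_lt ((ContinuousMap.norm_le _ (norm_nonneg (ξ - γ s))).2 ?_)
        (by simpa [dist_eq_norm] using hξ)
      intro x; simp
    have h2 := (ContinuousMap.dist_apply_le_dist (f := _) (g := _) s).trans (hclose h1).le
    simpa [dist_eq_norm] using h2
  filter_upwards [Metric.ball_mem_nhds γ hδ] with γ' hγ'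
  rw [ContinuousMap.norm_le _ (by positivity)]
  intro s
  have hs : γ' s ∈ Metric.ball (γ s) δ :=
    lt_of_le_of_lt (ContinuousMap.dist_apply_le_dist s) hγ'
  have h3 := (convex_ball (γ s) δ).norm_image_sub_le_of_norm_hasFDerivWithin_le'
    (f := w) (φ := w' (γ s)) (fun x _ => (hw x).hasFDerivWithinAt) (key s)
    (Metric.mem_ball_self hδ) hs
  refine (le_trans ?_ h3).trans ?_
  · simp
  · gcongr
    exact (γ' - γ).norm_coe_le_norm s

lemma contDiff_one_continuousMap_comp {w : F → G} (hw : ContDiff ℝ 1 w) :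
    ContDiff ℝ 1 (fun γ : C(K, F) => (⟨w, hw.continuous⟩ : C(F, G)).comp γ) := by
  obtain ⟨w', hw', hd⟩ := contDiff_one_iff_hasFDerivAt.1 hw
  exact contDiff_one_iff_hasFDerivAt.2 ⟨_,
    pointwiseApplyL.continuous.comp (ContinuousMap.continuous_postcomp ⟨w', hw'⟩),
    fun γ => hasFDerivAt_continuousMap_comp hd hw.continuous hw' γ⟩

end Nemytskii

section Primitive

variable {F : Type*} [NormedAddCommGroup F]

/-- The curve on `[0, 1]` extended to `ℝ` by constants. -/
noncomputable def unitExtend (γ : C(unitInterval, F)) (s : ℝ) : F :=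
  γ (Set.projIcc 0 1 zero_le_one s)

lemma continuous_unitExtend (γ : C(unitInterval, F)) : Continuous (unitExtend γ) :=
  γ.continuous.comp continuous_projIcc

lemma unitExtend_coe (γ : C(unitInterval, F)) (s : unitInterval) : unitExtend γ s = γ s := by
  simp [unitExtend]

variable [NormedSpace ℝ F]

/-- The primitive vanishing at `0` as a bounded operator on `C([0, 1], F)`. -/
noncomputable def primitiveL : C(unitInterval, F) →L[ℝ] C(unitInterval, F) :=
  LinearMap.mkContinuous
    { toFun := fun γ => ⟨fun s => ∫ r in (0 : ℝ)..s, unitExtend γ r,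
        (intervalIntegral.continuous_primitive
          (fun _ _ => (continuous_unitExtend γ).intervalIntegrable _ _) 0).comp
          continuous_subtype_val⟩
      map_add' := by
        intro γ γ'
        ext s
        exact intervalIntegral.integral_add
          ((continuous_unitExtend γ).intervalIntegrable _ _)
          ((continuous_unitExtend γ').intervalIntegrable _ _)
      map_smul' := by
        intro c γ
        ext s
        exact intervalIntegral.integral_smul c _ } 1 (by
    intro γ
    rw [ContinuousMap.norm_le _ (by positivity)]
    intro s
    have h := intervalIntegral.norm_integral_le_of_norm_le_const (a := (0 : ℝ)) (b := s)
      (f := unitExtend γ) (C := ‖γ‖) (fun r _ => γ.norm_coe_le_norm _)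
    have hs : |(s : ℝ) - 0| ≤ 1 := by
      rw [sub_zero, abs_of_nonneg s.2.1]; exact s.2.2
    refine h.trans ?_
    rw [mul_comm]
    gcongr)

lemma primitiveL_apply (γ : C(unitInterval, F)) (s : unitInterval) :
    primitiveL γ s = ∫ r in (0 : ℝ)..s, unitExtend γ r := rfl

end Primitive

lemma exists_local_curves {F : Type*} [NormedAddCommGroup F] [NormedSpace ℝ F] [CompleteSpace F]
    {w : F → F} (hw : ContDiff ℝ 1 w) (m : F) :
    ∃ Γ : F × ℝ → C(unitInterval, F), ContDiffAt ℝ 1 Γ (m, 0) ∧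
      Γ (m, 0) = ContinuousMap.const _ m ∧
      ∀ᶠ p in nhds (m, (0 : ℝ)), ∀ s : unitInterval,
        Γ p s = p.1 + p.2 • ∫ r in (0 : ℝ)..s, w (unitExtend (Γ p) r) := by
  let N : C(unitInterval, F) → C(unitInterval, F) := fun γ => (⟨w, hw.continuous⟩ : C(F, F)).comp γ
  have hN : ContDiff ℝ 1 N := contDiff_one_continuousMap_comp hw
  let cst : F →L[ℝ] C(unitInterval, F) := ContinuousLinearMap.const ℝ _
  let Φ : (F × ℝ) × C(unitInterval, F) → C(unitInterval, F) :=
    fun q => q.2 - cst q.1.1 - q.1.2 • primitiveL (N q.2)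
  have hΦ : ContDiff ℝ 1 Φ := by
    have h1 : ContDiff ℝ 1 (fun q : (F × ℝ) × C(unitInterval, F) => primitiveL (N q.2)) :=
      primitiveL.contDiff.comp (hN.comp contDiff_snd)
    have h2 : ContDiff ℝ 1 (fun q : (F × ℝ) × C(unitInterval, F) => cst q.1.1) :=
      cst.contDiff.comp (contDiff_fst.comp contDiff_fst)
    exact (contDiff_snd.sub h2).sub ((contDiff_snd.comp contDiff_fst).smul h1)
  let u : (F × ℝ) × C(unitInterval, F) := ((m, 0), cst m)
  have hinv : fderiv ℝ Φ u ∘L .inr ℝ (F × ℝ) C(unitInterval, F) = .id ℝ _ := by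
    have h1 : HasFDerivAt (fun γ : C(unitInterval, F) => Φ ((m, 0), γ))
        (fderiv ℝ Φ u ∘L .inr ℝ (F × ℝ) C(unitInterval, F)) (cst m) :=
      HasFDerivAt.comp (cst m) (hΦ.differentiable one_ne_zero u).hasFDerivAt
        (hasFDerivAt_prodMk_right _ _)
    have h2 : HasFDerivAt (fun γ : C(unitInterval, F) => Φ ((m, 0), γ)) (.id ℝ _) (cst m) := by
      have : (fun γ : C(unitInterval, F) => Φ ((m, 0), γ)) = fun γ => γ - cst m := by
        ext γ; simp [Φ]
      rw [this]
      exact (hasFDerivAt_id _).sub_const _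
    exact h1.unique h2
  have if₂ : (fderiv ℝ Φ u ∘L .inr ℝ (F × ℝ) C(unitInterval, F)).IsInvertible := by
    rw [hinv]; exact ⟨.refl ℝ _, rfl⟩
  have cdf : ContDiffAt ℝ 1 Φ u := hΦ.contDiffAt
  refine ⟨cdf.implicitFunction one_ne_zero if₂, cdf.contDiffAt_implicitFunction one_ne_zero if₂,
    cdf.implicitFunction_apply_self one_ne_zero if₂, ?_⟩
  filter_upwards [cdf.eventually_apply_implicitFunction one_ne_zero if₂] with p hp s
  generalize cdf.implicitFunction one_ne_zero if₂ p = γ at hp ⊢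
  have hu : Φ u = 0 := by simp [Φ, u]
  rw [hu] at hp
  simp only [Φ, sub_sub, sub_eq_zero] at hp
  have h1 := DFunLike.congr_fun hp s
  rw [ContinuousMap.add_apply, ContinuousMap.smul_apply, primitiveL_apply] at h1
  exact h1

lemma eqOn_Icc_of_contDiffOn {F : Type*} [NormedAddCommGroup F] [NormedSpace ℝ F]
    {D : Set F} (hD : IsOpen D) {v : F → F} (hv : ContDiffOn ℝ 1 v D) {c d : ℝ → F} {a e : ℝ}
    (hc : ContinuousOn c (Icc a e)) (hcD : ∀ t ∈ Icc a e, c t ∈ D)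
    (hc' : ∀ t ∈ Ico a e, HasDerivWithinAt c (v (c t)) (Ici t) t)
    (hd : ContinuousOn d (Icc a e)) (hdD : ∀ t ∈ Icc a e, d t ∈ D)
    (hd' : ∀ t ∈ Ico a e, HasDerivWithinAt d (v (d t)) (Ici t) t)
    (h : c a = d a) : EqOn c d (Icc a e) := by
  have hK : IsCompact (c '' Icc a e ∪ d '' Icc a e) :=
    (isCompact_Icc.image_of_continuousOn hc).union (isCompact_Icc.image_of_continuousOn hd)
  have hKD : c '' Icc a e ∪ d '' Icc a e ⊆ D := by
    rintro _ (⟨t, ht, rfl⟩ | ⟨t, ht, rfl⟩)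
    exacts [hcD t ht, hdD t ht]
  have hlip : LocallyLipschitzOn D v := by
    intro x hx
    obtain ⟨K, t, ht, hL⟩ := (hv.contDiffAt (hD.mem_nhds hx)).exists_lipschitzOnWith
    exact ⟨K, t, mem_nhdsWithin_of_mem_nhds ht, hL⟩
  obtain ⟨K, hL⟩ := (hlip.mono hKD).exists_lipschitzOnWith_of_compact hK
  refine ODE_solution_unique_of_mem_Icc_right (v := fun _ => v)
    (s := fun _ => c '' Icc a e ∪ d '' Icc a e) (fun t _ => hL) hc hc' ?_ hd hd' ?_ h
  · exact fun t ht => Or.inl ⟨t, Ico_subset_Icc_self ht, rfl⟩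
  · exact fun t ht => Or.inr ⟨t, Ico_subset_Icc_self ht, rfl⟩

lemma exists_contDiff_eventuallyEq {F G : Type*} [NormedAddCommGroup F] [NormedSpace ℝ F]
    [HasContDiffBump F] [NormedAddCommGroup G] [NormedSpace ℝ G] {w : F → G} {m : F}
    (hw : ContDiffAt ℝ 1 w m) :
    ∃ w' : F → G, ContDiff ℝ 1 w' ∧ w' =ᶠ[nhds m] w := by
  obtain ⟨δ, hδ, hball⟩ := Metric.eventually_nhds_iff_ball.1 (hw.eventually (by simp))
  let χ : ContDiffBump m := ⟨δ / 4, δ / 2, by positivity, by linarith⟩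
  refine ⟨fun x => χ x • w x, contDiff_iff_contDiffAt.2 fun x => ?_, ?_⟩
  · by_cases hx : x ∈ Metric.ball m δ
    · exact χ.contDiffAt.smul (hball x hx)
    · have hmem : (Metric.closedBall m (δ / 2))ᶜ ∈ nhds x := by
        refine Metric.isClosed_closedBall.isOpen_compl.mem_nhds fun h => hx ?_
        exact Metric.closedBall_subset_ball (by linarith) h
      refine (contDiffAt_const (c := (0 : G))).congr_of_eventuallyEq ?_
      filter_upwards [hmem] with y hy
      have : χ y = 0 := χ.zero_of_le_dist (by
        simp only [mem_compl_iff, Metric.mem_closedBall, not_le] at hy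
        exact hy.le)
      simp [this]
  · filter_upwards [χ.eventuallyEq_one] with x hx
    rw [hx, Pi.one_apply, one_smul]

section Flow

variable {n : ℕ} {D : Set (Euc n)} {b : Euc n → Euc n} {ψ : Euc n → ℝ → Euc n}

lemma GeoIsFlow.continuous (hψ : GeoIsFlow D b ψ) {x : Euc n} (hx : x ∈ D) :
    Continuous (ψ x) :=
  continuous_iff_continuousAt.2 fun t => (hψ.2.2 x hx t).continuousAt

lemma GeoIsFlow.hasDerivAt_mul (hψ : GeoIsFlow D b ψ) {x : Euc n} (hx : x ∈ D) (t s : ℝ) :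
    HasDerivAt (fun s => ψ x (t * s)) (t • b (ψ x (t * s))) s := by
  have h : HasDerivAt (fun s : ℝ => t * s) t s := by simpa using (hasDerivAt_id s).const_mul t
  exact (hψ.2.2 x hx (t * s)).scomp s h

/-- A solution of the time-rescaled equation on `[0, 1]` is given by the flow. -/
lemma GeoIsFlow.eq_of_hasDerivAt (hD : IsOpen D) (hb : ContDiffOn ℝ 1 b D)
    (hψ : GeoIsFlow D b ψ) {c : ℝ → Euc n} {t : ℝ} (hcD : ∀ s ∈ Icc (0 : ℝ) 1, c s ∈ D)
    (hc : ∀ s ∈ Icc (0 : ℝ) 1, HasDerivAt c (t • b (c s)) s) {s : ℝ} (hs : s ∈ Icc (0 : ℝ) 1) :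
    c s = ψ (c 0) (t * s) := by
  have h0 : c 0 ∈ D := hcD 0 (by simp)
  refine eqOn_Icc_of_contDiffOn hD (v := fun y => t • b y) (hb.const_smul t)
    (d := fun s => ψ (c 0) (t * s))
    (fun s hs => (hc s hs).continuousAt.continuousWithinAt) hcD
    (fun s hs => (hc s (Ico_subset_Icc_self hs)).hasDerivWithinAt)
    (fun s _ => (hψ.hasDerivAt_mul h0 t s).continuousAt.continuousWithinAt)
    (fun s _ => hψ.2.1 _ h0 _)
    (fun s _ => (hψ.hasDerivAt_mul h0 t s).hasDerivWithinAt) ?_ hs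
  simp [hψ.1 _ h0]

lemma GeoIsFlow.add (hD : IsOpen D) (hb : ContDiffOn ℝ 1 b D)
    (hψ : GeoIsFlow D b ψ) {x : Euc n} (hx : x ∈ D) (s t : ℝ) :
    ψ (ψ x s) t = ψ x (s + t) := by
  have h := hψ.eq_of_hasDerivAt hD hb (c := fun r => ψ x (s + t * r)) (t := t)
    (fun r _ => hψ.2.1 x hx _) (fun r _ => ?_) (s := 1) (by simp)
  · simpa using h.symm
  · have h1 : HasDerivAt (fun r : ℝ => s + t * r) t r := by
      simpa using ((hasDerivAt_id r).const_mul t).const_add s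
    exact (hψ.2.2 x hx (s + t * r)).scomp r h1

/-- Near `(m, 0)` the flow curves depend continuously differentiably on the initial point and on
the duration. -/
lemma GeoIsFlow.exists_contDiffAt_curves (hD : IsOpen D) (hb : ContDiffOn ℝ 1 b D)
    (hψ : GeoIsFlow D b ψ) {m : Euc n} (hm : m ∈ D) :
    ∃ Γ : Euc n × ℝ → C(unitInterval, Euc n), ContDiffAt ℝ 1 Γ (m, 0) ∧
      Γ (m, 0) = ContinuousMap.const _ m ∧
      ∀ᶠ p in nhds (m, (0 : ℝ)), p.1 ∈ D ∧ ∀ s : unitInterval, Γ p s = ψ p.1 (p.2 * s) := by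
  obtain ⟨w, hw, hwb⟩ := exists_contDiff_eventuallyEq (hb.contDiffAt (hD.mem_nhds hm))
  obtain ⟨Γ, hΓ, hΓm, hΓeq⟩ := exists_local_curves hw m
  refine ⟨Γ, hΓ, hΓm, ?_⟩
  obtain ⟨δ, hδ, hball⟩ :=
    Metric.eventually_nhds_iff_ball.1 (hwb.and (hD.eventually_mem hm))
  have hnear : ∀ᶠ p in nhds (m, (0 : ℝ)), dist (Γ p) (Γ (m, 0)) < δ :=
    hΓ.continuousAt.eventually (Metric.ball_mem_nhds _ hδ)
  filter_upwards [hΓeq, hnear] with p hp hpδ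
  have hmem : ∀ s : ℝ, unitExtend (Γ p) s ∈ Metric.ball m δ := by
    intro s
    have := (ContinuousMap.dist_apply_le_dist (f := Γ p) (g := Γ (m, 0))
      (projIcc 0 1 zero_le_one s)).trans_lt hpδ
    rw [hΓm] at this
    exact this
  let c : ℝ → Euc n := fun s => p.1 + p.2 • ∫ r in (0 : ℝ)..s, w (unitExtend (Γ p) r)
  have hcont : Continuous fun r => w (unitExtend (Γ p) r) :=
    hw.continuous.comp (continuous_unitExtend _)
  have hcs : ∀ s ∈ Icc (0 : ℝ) 1, c s = unitExtend (Γ p) s := fun s hs =>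
    ((unitExtend_coe (Γ p) ⟨s, hs⟩).trans (hp ⟨s, hs⟩)).symm
  have hc0 : c 0 = p.1 := by simp [c]
  have hcD : ∀ s ∈ Icc (0 : ℝ) 1, c s ∈ D := fun s hs => by
    rw [hcs s hs]; exact (hball _ (hmem s)).2
  refine ⟨hc0 ▸ hcD 0 (by simp), fun s => ?_⟩
  have h := hψ.eq_of_hasDerivAt hD hb (c := c) (t := p.2) hcD (fun r hr => ?_) s.2
  · rw [hc0] at h
    rw [← h, hcs s s.2, unitExtend_coe]
  · have h1 : HasDerivAt c (p.2 • w (unitExtend (Γ p) r)) r :=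
      ((hcont.integral_hasStrictDerivAt 0 r).hasDerivAt.const_smul p.2).const_add p.1
    rwa [(hball _ (hmem r)).1, ← hcs r hr] at h1

/-- If `h` vanishes at `m` and increases along the flow there, then the time at which the flow
reaches the zero set of `h` and the corresponding arclength are continuously differentiable
near `m`. -/
lemma GeoIsFlow.exists_local_hitting_time (hD : IsOpen D) (hb : ContDiffOn ℝ 1 b D)
    (hψ : GeoIsFlow D b ψ) {m : Euc n} (hm : m ∈ D) {h : Euc n → ℝ} (hh : ContDiffAt ℝ 1 h m)
    (hm0 : h m = 0) (hpos : 0 < fderiv ℝ h m (b m)) :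
    ∃ S : Euc n → ℝ, (∀ᶠ x in nhds m, x ∈ D ∧ h (ψ x (S x)) = 0) ∧
      ContDiffAt ℝ 1 (fun x => ∫ r in S x..0, ‖b (ψ x r)‖) m := by
  obtain ⟨Γ, hΓ, hΓm, hΓψ⟩ := hψ.exists_contDiffAt_curves hD hb hm
  let ev : C(unitInterval, Euc n) →L[ℝ] Euc n := ContinuousMap.evalCLM ℝ 1
  let g : Euc n × ℝ → ℝ := fun p => h (ev (Γ p))
  have hev : ev (Γ (m, 0)) = m := by rw [hΓm]; rfl
  have hevψ : ∀ᶠ p in nhds (m, (0 : ℝ)), ev (Γ p) = ψ p.1 p.2 := by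
    filter_upwards [hΓψ] with p hp
    have h1 := hp.2 1
    rw [Set.Icc.coe_one, mul_one] at h1
    exact h1
  have hg : ContDiffAt ℝ 1 g (m, 0) :=
    ContDiffAt.comp (m, (0 : ℝ)) (g := h) (f := fun p => ev (Γ p)) (by rwa [hev])
      (ev.contDiff.contDiffAt.comp _ hΓ)
  have hg0 : g (m, 0) = 0 := by simp only [g, hev, hm0]
  have hder : HasDerivAt (fun t => g (m, t)) (fderiv ℝ h m (b m)) 0 := by
    have h0 : ψ m 0 = m := hψ.1 m hm
    have h1 : HasDerivAt (fun t => h (ψ m t)) (fderiv ℝ h m (b m)) 0 := by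
      have h2 : HasFDerivAt h (fderiv ℝ h m) (ψ m 0) := by
        rw [h0]; exact (hh.differentiableAt one_ne_zero).hasFDerivAt
      have h3 := hψ.2.2 m hm 0
      rw [h0] at h3
      exact h2.comp_hasDerivAt 0 h3
    refine h1.congr_of_eventuallyEq ?_
    have : Filter.Tendsto (fun t : ℝ => (m, t)) (nhds 0) (nhds (m, 0)) :=
      (Continuous.prodMk_right m).tendsto 0
    filter_upwards [this.eventually hevψ] with t ht
    simp only [g, ht]
  have hinv : (fderiv ℝ g (m, 0) ∘L .inr ℝ (Euc n) ℝ).IsInvertible := by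
    have h1 : HasFDerivAt (fun t => g (m, t)) (fderiv ℝ g (m, 0) ∘L .inr ℝ (Euc n) ℝ) (0 : ℝ) :=
      HasFDerivAt.comp (0 : ℝ) (hg.differentiableAt one_ne_zero).hasFDerivAt
        (hasFDerivAt_prodMk_right _ _)
    rw [h1.unique hder.hasFDerivAt]
    exact ⟨ContinuousLinearEquiv.unitsEquivAut ℝ (Units.mk0 _ hpos.ne'), by ext; simp⟩
  let S := hg.implicitFunction one_ne_zero hinv
  have hS : ContDiffAt ℝ 1 S m := hg.contDiffAt_implicitFunction one_ne_zero hinv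
  have hSm : S m = 0 := hg.implicitFunction_apply_self one_ne_zero hinv
  have hgS : ∀ᶠ x in nhds m, g (x, S x) = 0 := by
    simpa only [hg0] using hg.eventually_apply_implicitFunction one_ne_zero hinv
  have hpair : ContDiffAt ℝ 1 (fun x => (x, S x)) m := contDiffAt_id.prodMk hS
  have htend : Filter.Tendsto (fun x => (x, S x)) (nhds m) (nhds (m, 0)) := by
    have := hpair.continuousAt.tendsto
    rwa [hSm] at this
  refine ⟨S, ?_, ?_⟩
  · filter_upwards [hgS, htend.eventually hevψ, htend.eventually hΓψ] with x h1 h2 h3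
    refine ⟨h3.1, ?_⟩
    rw [← h1, ← h2]
  · have hbm : b m ≠ 0 := by
      intro h0; simp [h0] at hpos
    have hbD := hb.contDiffAt (hD.mem_nhds hm)
    obtain ⟨β, hβ, hβb⟩ := exists_contDiff_eventuallyEq (hbD.norm ℝ hbm)
    obtain ⟨δ, hδ, hball⟩ := Metric.eventually_nhds_iff_ball.1 hβb
    have hnear : ∀ᶠ p in nhds (m, (0 : ℝ)), dist (Γ p) (Γ (m, 0)) < δ :=
      hΓ.continuousAt.eventually (Metric.ball_mem_nhds _ hδ)
    let N : C(unitInterval, Euc n) → C(unitInterval, ℝ) :=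
      fun γ => (⟨β, hβ.continuous⟩ : C(Euc n, ℝ)).comp γ
    have hN : ContDiff ℝ 1 N := contDiff_one_continuousMap_comp hβ
    let I : C(unitInterval, ℝ) →L[ℝ] ℝ := ContinuousMap.evalCLM ℝ 1 ∘L primitiveL
    let A : C(unitInterval, Euc n) → ℝ := fun γ => I (N γ)
    have hA : ContDiff ℝ 1 A := I.contDiff.comp hN
    have hmain : ContDiffAt ℝ 1 (fun x => -(S x * A (Γ (x, S x)))) m := by
      refine (hS.mul (hA.contDiffAt.comp m ?_)).neg
      exact ContDiffAt.comp m (g := Γ) (by rwa [hSm]) hpair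
    refine hmain.congr_of_eventuallyEq ?_
    filter_upwards [htend.eventually hnear, htend.eventually hΓψ] with x h1 h2
    rw [intervalIntegral.integral_symm]
    congr 1
    have h3 : A (Γ (x, S x)) = ∫ s in (0 : ℝ)..1, ‖b (ψ x (S x * s))‖ := by
      change (∫ s in (0 : ℝ)..1, β (unitExtend (Γ (x, S x)) s)) = _
      refine intervalIntegral.integral_congr fun s hs => ?_
      rw [uIcc_of_le zero_le_one] at hs
      have h4 : unitExtend (Γ (x, S x)) s = ψ x (S x * s) :=
        (unitExtend_coe _ ⟨s, hs⟩).trans (h2.2 ⟨s, hs⟩)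
      have h5 : unitExtend (Γ (x, S x)) s ∈ Metric.ball m δ := by
        have := (ContinuousMap.dist_apply_le_dist (f := Γ (x, S x)) (g := Γ (m, 0))
          (projIcc 0 1 zero_le_one s)).trans_lt h1
        rw [hΓm] at this
        exact this
      change β (unitExtend (Γ (x, S x)) s) = ‖b (ψ x (S x * s))‖
      rw [hball _ h5, h4]
    rw [h3]
    have h6 := intervalIntegral.smul_integral_comp_mul_left (a := 0) (b := 1)
      (fun r => ‖b (ψ x r)‖) (S x)
    simpa using h6.symm

end Flow

lemma pos_of_deriv_pos_of_zeros {g : ℝ → ℝ} (hg : Continuous g)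
    (hd : ∀ t, g t = 0 → 0 < deriv g t) {a t : ℝ} (ha : g a = 0) (hat : a < t) : 0 < g t := by
  by_contra! hle
  have hright : ∀ᶠ s in nhdsWithin a (Ioi a), 0 < g s := by
    filter_upwards [nhdsWithin_le_nhds (eventually_nhdsWithin_sign_eq_of_deriv_pos (hd a ha) ha),
      self_mem_nhdsWithin] with s hs has
    rwa [sign_pos (sub_pos.2 has), sign_eq_one_iff] at hs
  obtain ⟨u, hau, hu⟩ := mem_nhdsGT_iff_exists_Ioo_subset.1 hright
  have hut : u ≤ t := by
    by_contra! h
    exact hle.not_gt (hu ⟨hat, h⟩)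
  have hcomp : IsCompact (Icc u t ∩ g ⁻¹' Iic 0) :=
    isCompact_Icc.inter_right (isClosed_Iic.preimage hg)
  obtain ⟨c, ⟨hc, hgc⟩, hmin⟩ := hcomp.exists_isLeast ⟨t, ⟨hut, le_rfl⟩, hle⟩
  have hac : a < c := lt_of_lt_of_le hau hc.1
  have hpos : ∀ s ∈ Ioo a c, 0 < g s := by
    intro s hs
    rcases lt_or_ge s u with h | h
    · exact hu ⟨hs.1, h⟩
    · by_contra! hn
      exact hs.2.not_ge (hmin ⟨⟨h, hs.2.le.trans hc.2⟩, hn⟩)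
  have hleft : ∀ᶠ s in nhdsWithin c (Iio c), 0 < g s :=
    Filter.mem_of_superset (Ioo_mem_nhdsLT hac) hpos
  have hgc0 : g c = 0 := le_antisymm hgc
    (ge_of_tendsto (hg.continuousWithinAt (s := Iio c) (x := c)) (hleft.mono fun _ h => h.le))
  have hneg : ∀ᶠ s in nhdsWithin c (Iio c), g s < 0 := by
    filter_upwards [nhdsWithin_le_nhds
      (eventually_nhdsWithin_sign_eq_of_deriv_pos (hd c hgc0) hgc0), self_mem_nhdsWithin]
      with s hs hsc
    rwa [sign_neg (sub_neg.2 hsc), sign_eq_neg_one_iff] at hs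
  obtain ⟨s, h1, h2⟩ := (hleft.and hneg).exists
  exact h1.not_gt h2

/-- A continuous function that is increasing at each of its zeros changes sign at most once. -/
lemma sign_eq_of_deriv_pos_of_zeros {g : ℝ → ℝ} (hg : Continuous g)
    (hd : ∀ t, g t = 0 → 0 < deriv g t) {a : ℝ} (ha : g a = 0) (t : ℝ) :
    SignType.sign (g t) = SignType.sign (t - a) := by
  rcases lt_trichotomy t a with h | rfl | h
  · have h1 : 0 < -g (-(-t)) := by
      refine pos_of_deriv_pos_of_zeros (g := fun s => -g (-s)) (a := -a) (by fun_prop) ?_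
        (by simpa using ha) (neg_lt_neg h)
      intro s hs
      have := hd (-s) (by simpa using hs)
      have hder : HasDerivAt (fun s => -g (-s)) (deriv g (-s)) s := by
        have h2 := (differentiableAt_of_deriv_ne_zero this.ne').hasDerivAt
        have h3 : HasDerivAt (fun s => g (-s)) (deriv g (-s) * -1) s :=
          h2.comp s (hasDerivAt_neg s)
        simpa using h3.fun_neg
      rwa [hder.deriv]
    rw [neg_neg] at h1
    rw [sign_neg (by linarith : g t < 0), sign_neg (sub_neg.2 h)]
  · simp [ha]
  · rw [sign_pos (pos_of_deriv_pos_of_zeros hg hd ha h), sign_pos (sub_pos.2 h)]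

/-- Signed arclength from `M` along the flow lines, as a function on a neighbourhood of `M`. -/
lemma GeoIsFlow.exists_arclength {n : ℕ} {D : Set (Euc n)} {b : Euc n → Euc n}
    {ψ : Euc n → ℝ → Euc n} (hD : IsOpen D) (hb : ContDiffOn ℝ 1 b D) (hψ : GeoIsFlow D b ψ)
    {h : Euc n → ℝ} (hh : ContinuousOn h D)
    (hM : ∀ x ∈ D, h x = 0 → ContDiffAt ℝ 1 h x ∧ 0 < fderiv ℝ h x (b x)) :
    ∃ (F : Euc n → ℝ) (W : Set (Euc n)), IsOpen W ∧ {x ∈ D | h x = 0} ⊆ W ∧ W ⊆ D ∧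
      ∀ x ∈ W, ContDiffAt ℝ 1 F x ∧ b x ≠ 0 ∧ fderiv ℝ F x (b x) = ‖b x‖ ∧
        SignType.sign (F x) = SignType.sign (h x) := by
  classical
  have hzero : ∀ x ∈ D, ∀ t, h (ψ x t) = 0 → 0 < deriv (fun t => h (ψ x t)) t := by
    intro x hx t ht
    obtain ⟨h1, h2⟩ := hM _ (hψ.2.1 x hx t) ht
    have h3 : HasDerivAt (fun t => h (ψ x t)) (fderiv ℝ h (ψ x t) (b (ψ x t))) t :=
      (h1.differentiableAt one_ne_zero).hasFDerivAt.comp_hasDerivAt t (hψ.2.2 x hx t)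
    rwa [h3.deriv]
  have hsign : ∀ x ∈ D, ∀ a, h (ψ x a) = 0 → ∀ t,
      SignType.sign (h (ψ x t)) = SignType.sign (t - a) := fun x hx a ha t =>
    sign_eq_of_deriv_pos_of_zeros (hh.comp_continuous (hψ.continuous hx) (hψ.2.1 x hx))
      (hzero x hx) ha t
  have huniq : ∀ x ∈ D, ∀ a t, h (ψ x a) = 0 → h (ψ x t) = 0 → t = a := by
    intro x hx a t ha ht
    have := hsign x hx a ha t
    rw [ht, sign_zero, eq_comm, sign_eq_zero_iff, sub_eq_zero] at this
    exact this
  let σ : Euc n → ℝ := fun x => if H : ∃ t, h (ψ x t) = 0 then H.choose else 0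
  have hσ : ∀ x, (∃ t, h (ψ x t) = 0) → h (ψ x (σ x)) = 0 := by
    intro x H
    simp only [σ, dif_pos H]
    exact H.choose_spec
  let F : Euc n → ℝ := fun x => ∫ r in σ x..0, ‖b (ψ x r)‖
  let W : Set (Euc n) := {x | ContDiffAt ℝ 1 F x} ∩ (interior {x | ∃ t, h (ψ x t) = 0} ∩
    (D ∩ b ⁻¹' {0}ᶜ))
  have hspeed : ∀ x ∈ D, Continuous fun r => ‖b (ψ x r)‖ := fun x hx =>
    (hb.continuousOn.comp_continuous (hψ.continuous hx) (hψ.2.1 x hx)).norm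
  refine ⟨F, W, ?_, ?_, fun x hx => hx.2.2.1, fun x hx => ?_⟩
  · refine IsOpen.inter ?_ (isOpen_interior.inter
      (hb.continuousOn.isOpen_inter_preimage hD isOpen_compl_singleton))
    exact isOpen_iff_mem_nhds.2 fun x hx => ContDiffAt.eventually hx (by simp)
  · rintro m ⟨hm, hm0⟩
    obtain ⟨h1, h2⟩ := hM m hm hm0
    have hbm : b m ≠ 0 := fun h0 => by simp [h0] at h2
    obtain ⟨S, hS, hSF⟩ := hψ.exists_local_hitting_time hD hb hm h1 hm0 h2
    refine ⟨hSF.congr_of_eventuallyEq ?_, ?_, hm, hbm⟩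
    · filter_upwards [hS] with x hx
      simp only [F, huniq x hx.1 _ _ hx.2 (hσ x ⟨_, hx.2⟩)]
    · exact mem_interior_iff_mem_nhds.2 (hS.mono fun x hx => ⟨_, hx.2⟩)
  · obtain ⟨hFx, hHx, hxD, hbx⟩ := hx
    replace hFx : ContDiffAt ℝ 1 F x := hFx
    have hH : x ∈ {x | ∃ t, h (ψ x t) = 0} := interior_subset hHx
    have hσx := hσ x hH
    have hx0 : ψ x 0 = x := hψ.1 x hxD
    refine ⟨hFx, hbx, ?_, ?_⟩
    · have hFs : ∀ s, F (ψ x s) = ∫ r in σ x..s, ‖b (ψ x r)‖ := by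
        intro s
        have h1 : h (ψ (ψ x s) (σ x - s)) = 0 := by
          rw [hψ.add hD hb hxD, add_sub_cancel, hσx]
        have h2 := huniq _ (hψ.2.1 x hxD s) _ _ h1 (hσ _ ⟨_, h1⟩)
        simp only [F, h2, hψ.add hD hb hxD]
        rw [intervalIntegral.integral_comp_add_left (fun r => ‖b (ψ x r)‖), add_zero,
          add_sub_cancel]
      have h3 : HasDerivAt (fun s => F (ψ x s)) ‖b x‖ 0 := by
        have := ((hspeed x hxD).integral_hasStrictDerivAt (σ x) 0).hasDerivAt
        rw [hx0] at this
        exact this.congr_of_eventuallyEq (Filter.Eventually.of_forall hFs)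
      have h4 : HasDerivAt (fun s => F (ψ x s)) (fderiv ℝ F x (b x)) 0 := by
        have h5 : HasFDerivAt F (fderiv ℝ F x) (ψ x 0) := by
          rw [hx0]; exact (hFx.differentiableAt one_ne_zero).hasFDerivAt
        have h6 := hψ.2.2 x hxD 0
        rw [hx0] at h6
        exact h5.comp_hasDerivAt 0 h6
      exact h4.unique h3
    · have h1 := hsign x hxD _ hσx 0
      rw [hx0, zero_sub] at h1
      rw [h1]
      have h2 : 0 < ‖b (ψ x 0)‖ := by rw [hx0]; exact norm_pos_iff.2 hbx
      rcases lt_trichotomy (σ x) 0 with h3 | h3 | h3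
      · rw [sign_pos (neg_pos.2 h3), sign_pos]
        exact intervalIntegral.integral_pos h3 (hspeed x hxD).continuousOn
          (fun _ _ => norm_nonneg _) ⟨0, ⟨h3.le, le_rfl⟩, h2⟩
      · simp [F, h3]
      · rw [sign_neg (neg_neg_iff_pos.2 h3), sign_neg]
        simp only [F]
        rw [intervalIntegral.integral_symm, neg_lt_zero]
        exact intervalIntegral.integral_pos h3 (hspeed x hxD).continuousOn
          (fun _ _ => norm_nonneg _) ⟨0, ⟨le_rfl, h3.le⟩, h2⟩

/-- Truncation of a local function `F` with the same sign as `h` to a global function. -/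
lemma exists_truncation {X : Type*} [TopologicalSpace X] [T2Space X] [LocallyCompactSpace X]
    {D W : Set X}
    (hW : IsOpen W) (hWD : W ⊆ D) {h F : X → ℝ} (hh : ContinuousOn h D)
    (hF : ContinuousOn F W) (hsign : ∀ x ∈ W, SignType.sign (F x) = SignType.sign (h x))
    (hMc : IsCompact {x ∈ D | h x = 0}) (hMW : {x ∈ D | h x = 0} ⊆ W) (hD : IsOpen D) :
    ∃ ε > (0 : ℝ), ∃ (f : X → ℝ) (K : Set X), IsCompact K ∧ K ⊆ W ∧ ContinuousOn f D ∧
      {x ∈ D | f x = 0} = {x ∈ D | h x = 0} ∧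
      ∀ x ∈ D, f x ∈ Ioo (-ε) ε → x ∈ K ∧ f =ᶠ[nhds x] F := by
  classical
  obtain ⟨K, hK, hMK, hKW⟩ := exists_compact_between hMc hW hMW
  have hne : ∀ x ∈ frontier K, F x ≠ 0 := by
    intro x hx h0
    have hxW : x ∈ W := hKW (hK.isClosed.frontier_subset hx)
    have h1 := hsign x hxW
    rw [h0, sign_zero, eq_comm, sign_eq_zero_iff] at h1
    exact hx.2 (hMK ⟨hWD hxW, h1⟩)
  obtain ⟨ε, hε, hεF⟩ : ∃ ε > (0 : ℝ), ∀ x ∈ frontier K, ε < |F x| := by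
    have hfr : IsCompact (frontier K) := hK.of_isClosed_subset isClosed_frontier
      hK.isClosed.frontier_subset
    rcases (frontier K).eq_empty_or_nonempty with he | hn
    · exact ⟨1, one_pos, by simp [he]⟩
    · obtain ⟨y, hy, hmin⟩ := hfr.exists_isMinOn hn
        ((hF.mono (hK.isClosed.frontier_subset.trans hKW)).abs)
      have hpos : 0 < |F y| := abs_pos.2 (hne y hy)
      exact ⟨|F y| / 2, by positivity, fun x hx =>
        lt_of_lt_of_le (half_lt_self hpos) (hmin hx)⟩
  let f : X → ℝ := fun x => if x ∈ K then max (-ε) (min ε (F x)) else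
    if 0 < h x then ε else -ε
  have hfK : ∀ x ∈ K, f x = max (-ε) (min ε (F x)) := fun x hx => if_pos hx
  have hfKc : ∀ x ∉ K, f x = if 0 < h x then ε else -ε := fun x hx => if_neg hx
  have hpos_out : ∀ x ∈ D, x ∉ interior K → 0 < h x → ∀ᶠ y in nhds x, f y = ε := by
    intro x hx hxK hhx
    have h1 : ∀ᶠ y in nhds x, 0 < h y :=
      (hh.continuousAt (hD.mem_nhds hx)).eventually (lt_mem_nhds hhx)
    by_cases hxK' : x ∈ K
    · have hxW := hKW hxK'
      have hFx : 0 < F x := by rw [← sign_eq_one_iff, hsign x hxW, sign_pos hhx]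
      have hlt : ε < F x := by
        have := hεF x ⟨subset_closure hxK', hxK⟩
        rwa [abs_of_pos hFx] at this
      filter_upwards [h1, (hF.continuousAt (hW.mem_nhds hxW)).eventually (lt_mem_nhds hlt)]
        with y hy hFy
      by_cases hyK : y ∈ K
      · rw [hfK y hyK, min_eq_left hFy.le, max_eq_right (by linarith)]
      · rw [hfKc y hyK, if_pos hy]
    · filter_upwards [h1, hK.isClosed.isOpen_compl.mem_nhds hxK'] with y hy hyK
      rw [hfKc y hyK, if_pos hy]
  have hneg_out : ∀ x ∈ D, x ∉ interior K → h x < 0 → ∀ᶠ y in nhds x, f y = -ε := by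
    intro x hx hxK hhx
    have h1 : ∀ᶠ y in nhds x, h y < 0 :=
      (hh.continuousAt (hD.mem_nhds hx)).eventually (gt_mem_nhds hhx)
    by_cases hxK' : x ∈ K
    · have hxW := hKW hxK'
      have hFx : F x < 0 := by rw [← sign_eq_neg_one_iff, hsign x hxW, sign_neg hhx]
      have hlt : F x < -ε := by
        have := hεF x ⟨subset_closure hxK', hxK⟩
        rw [abs_of_neg hFx] at this
        linarith
      filter_upwards [h1, (hF.continuousAt (hW.mem_nhds hxW)).eventually (gt_mem_nhds hlt)]
        with y hy hFy
      by_cases hyK : y ∈ K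
      · rw [hfK y hyK, min_eq_right (by linarith), max_eq_left hFy.le]
      · rw [hfKc y hyK, if_neg hy.not_gt]
    · filter_upwards [h1, hK.isClosed.isOpen_compl.mem_nhds hxK'] with y hy hyK
      rw [hfKc y hyK, if_neg hy.not_gt]
  have hout : ∀ x ∈ D, x ∉ interior K →
      ∃ c : ℝ, (c = ε ∨ c = -ε) ∧ ∀ᶠ y in nhds x, f y = c := by
    intro x hx hxK
    rcases lt_trichotomy (h x) 0 with h0 | h0 | h0
    · exact ⟨-ε, Or.inr rfl, hneg_out x hx hxK h0⟩
    · exact absurd (hMK ⟨hx, h0⟩) hxK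
    · exact ⟨ε, Or.inl rfl, hpos_out x hx hxK h0⟩
  have hin : ∀ x ∈ interior K, f =ᶠ[nhds x] fun y => max (-ε) (min ε (F y)) := fun x hx =>
    Filter.eventually_of_mem (mem_interior_iff_mem_nhds.1 hx) hfK
  have hFc : ∀ x ∈ interior K, ContinuousAt F x := fun x hx =>
    hF.continuousAt (hW.mem_nhds (hKW (interior_subset hx)))
  have hE : ∀ x ∈ D, f x ∈ Ioo (-ε) ε → x ∈ interior K := by
    intro x hx hfx
    by_contra hxK
    obtain ⟨c, hc, hfc⟩ := hout x hx hxK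
    rw [hfc.self_of_nhds] at hfx
    rcases hc with rfl | rfl
    exacts [lt_irrefl _ hfx.2, lt_irrefl _ hfx.1]
  have hval : ∀ y : ℝ, y ∈ Ioo (-ε) ε → max (-ε) (min ε y) = y := fun y hy => by
    rw [min_eq_right hy.2.le, max_eq_right hy.1.le]
  have hval' : ∀ y : ℝ, max (-ε) (min ε y) ∈ Ioo (-ε) ε → y ∈ Ioo (-ε) ε := by
    rintro y ⟨h1, h2⟩
    constructor
    · rcases lt_max_iff.1 h1 with h3 | h3
      · exact absurd h3 (lt_irrefl _)
      · exact (lt_min_iff.1 h3).2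
    · rcases min_lt_iff.1 (max_lt_iff.1 h2).2 with h3 | h3
      · exact absurd h3 (lt_irrefl _)
      · exact h3
  have hEF : ∀ x ∈ D, f x ∈ Ioo (-ε) ε → F x ∈ Ioo (-ε) ε := fun x hx hfx =>
    hval' _ (hfK x (interior_subset (hE x hx hfx)) ▸ hfx)
  have heq : ∀ x ∈ interior K, F x ∈ Ioo (-ε) ε → f =ᶠ[nhds x] F := fun x hx hFx => by
    filter_upwards [hin x hx, (hFc x hx).eventually (Ioo_mem_nhds hFx.1 hFx.2)] with y h1 h2
    rw [h1, hval _ h2]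
  refine ⟨ε, hε, f, K, hK, hKW, ?_, ?_, ?_⟩
  · intro x hx
    refine ContinuousAt.continuousWithinAt ?_
    by_cases hxK : x ∈ interior K
    · have h1 : ContinuousAt (fun y => max (-ε) (min ε (F y))) x :=
        continuousAt_const.max (continuousAt_const.min (hFc x hxK))
      exact h1.congr (hin x hxK).symm
    · obtain ⟨c, -, hc⟩ := hout x hx hxK
      exact continuousAt_const.congr (hc.mono fun _ h => h.symm)
  · ext x
    refine and_congr_right fun hx => ⟨fun h0 => ?_, fun h0 => ?_⟩
    · have hfx : f x ∈ Ioo (-ε) ε := by rw [h0]; exact ⟨by linarith, hε⟩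
      have hxK := hE x hx hfx
      have h1 := (heq x hxK (hEF x hx hfx)).self_of_nhds
      have h2 := hsign x (hKW (interior_subset hxK))
      rw [← h1, h0, sign_zero, eq_comm, sign_eq_zero_iff] at h2
      exact h2
    · have hxK := hMK ⟨hx, h0⟩
      have h2 := hsign x (hKW (interior_subset hxK))
      rw [h0, sign_zero, sign_eq_zero_iff] at h2
      rw [(heq x hxK (by rw [h2]; exact ⟨by linarith, hε⟩)).self_of_nhds, h2]
  · exact fun x hx hfx =>
      ⟨interior_subset (hE x hx hfx), heq x (hE x hx hfx) (hEF x hx hfx)⟩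

/-- from an admissible manifold `M` one can construct a flowline
tracing function `f` with `f⁻¹({0}) = M`, tracing the flowlines of `b` between
`-ε` and `ε`, whose transition region `E = f⁻¹((-ε,ε))` has compact closure in
`D`, contains no zero of `b`, and on which `∇f` is bounded. -/
theorem statement13 {n : ℕ} (D : Set (Euc n)) (hD : IsOpen D) (hDne : D.Nonempty)
    (b : Euc n → Euc n) (hb : ContDiffOn ℝ 1 b D)
    (ψ : Euc n → ℝ → Euc n) (hψ : GeoIsFlow D b ψ)
    (M : Set (Euc n)) (hM : GeoIsAdmissible D b M) :
    ∃ ε > (0:ℝ), ∃ f : Euc n → ℝ,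
      ContinuousOn f D ∧
      {w ∈ D | f w = 0} = M ∧
      ContDiffOn ℝ 1 f {w ∈ D | f w ∈ Set.Ioo (-ε) ε} ∧
      (∀ x ∈ {w ∈ D | f w ∈ Set.Ioo (-ε) ε}, ⟪gradient f x, b x⟫ = ‖b x‖) ∧
      IsCompact (closure {w ∈ D | f w ∈ Set.Ioo (-ε) ε}) ∧
      closure {w ∈ D | f w ∈ Set.Ioo (-ε) ε} ⊆ D ∧
      (∀ x ∈ closure {w ∈ D | f w ∈ Set.Ioo (-ε) ε}, b x ≠ 0) ∧
      (∃ C : ℝ, ∀ x ∈ {w ∈ D | f w ∈ Set.Ioo (-ε) ε}, ‖gradient f x‖ ≤ C) := by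

  obtain ⟨h, hh, rfl, hMc, ⟨U, hU, hMU, -, hhU⟩, hgrad⟩ := hM
  obtain ⟨F, W, hW, hMW, hWD, hF⟩ := hψ.exists_arclength hD hb hh fun x hx h0 =>
    ⟨hhU.contDiffAt (hU.mem_nhds (hMU ⟨hx, h0⟩)), by
      simpa only [inner_gradient_left] using hgrad x ⟨hx, h0⟩⟩
  obtain ⟨ε, hε, f, K, hK, hKW, hf, hf0, hfE⟩ := exists_truncation hW hWD hh
    (fun x hx => (hF x hx).1.continuousAt.continuousWithinAt) (fun x hx => (hF x hx).2.2.2)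
    hMc hMW hD
  have hcl : closure {w ∈ D | f w ∈ Ioo (-ε) ε} ⊆ K :=
    closure_minimal (fun x hx => (hfE x hx.1 hx.2).1) hK.isClosed
  refine ⟨ε, hε, f, hf, hf0, ?_, ?_, hK.of_isClosed_subset isClosed_closure hcl,
    hcl.trans (hKW.trans hWD), fun x hx => (hF x (hKW (hcl hx))).2.1, ?_⟩
  · rintro x ⟨hx, hfx⟩
    obtain ⟨hxK, heq⟩ := hfE x hx hfx
    exact ((hF x (hKW hxK)).1.congr_of_eventuallyEq heq).contDiffWithinAt
  · rintro x ⟨hx, hfx⟩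
    obtain ⟨hxK, heq⟩ := hfE x hx hfx
    rw [heq.gradient_eq, inner_gradient_left, (hF x (hKW hxK)).2.2.1]
  · have hcont : ContinuousOn (fderiv ℝ F) K := fun x hx =>
      ((hF x (hKW hx)).1.fderiv_right (m := 0) (by simp)).continuousAt.continuousWithinAt
    obtain ⟨C, hC⟩ := hK.exists_bound_of_continuousOn hcont
    refine ⟨C, ?_⟩
    rintro x ⟨hx, hfx⟩
    obtain ⟨hxK, heq⟩ := hfE x hx hfx
    rw [heq.gradient_eq, gradient, LinearIsometryEquiv.norm_map]
    exact hC x hxK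
end
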